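/- Let K be any field and n an odd positive integer. If K(Z/nZ) is rational (purely transcendental) over K, then K(D_n) is stably rational over K. -/

import Mathlib

set_option synthInstance.maxHeartbeats 1000000
set_option maxHeartbeats 1000000

noncomputable section

/-- The rational function field `K(x(g) : g ∈ G)` in variables indexed by `G`. -/
abbrev NoetherBigField (K : Type*) [Field K] (G : Type*) : Type _ :=
  FractionRing (MvPolynomial G K)

/-- The `K`-automorphism of `K(x(g) : g ∈ G)` induced by `h · x(g) = x(hg)`. -/
def noetherAut (K : Type*) [Field K] (G : Type*) [Group G] (h : G) :
    NoetherBigField K G ≃ₐ[K] NoetherBigField K G :=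
  IsFractionRing.algEquivOfAlgEquiv (MvPolynomial.renameEquiv K (Equiv.mulLeft h))

/-- The fixed field `K(G) = K(x(g) : g ∈ G)^G`, as a subfield. -/
def noetherSubfield (K : Type*) [Field K] (G : Type*) [Group G] :
    Subfield (NoetherBigField K G) where
  carrier := {x | ∀ h : G, noetherAut K G h x = x}
  mul_mem' := by intro a b ha hb h; rw [map_mul, ha h, hb h]
  one_mem' := by intro h; rw [map_one]
  add_mem' := by intro a b ha hb h; rw [map_add, ha h, hb h]
  zero_mem' := by intro h; rw [map_zero]
  neg_mem' := by intro a ha h; rw [map_neg, ha h]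
  inv_mem' := by intro a ha h; rw [map_inv₀, ha h]

/-- Noether's fixed field `K(G) = K(x(g) : g ∈ G)^G`. -/
def NoetherField (K : Type*) [Field K] (G : Type*) [Group G] : Type _ :=
  noetherSubfield K G

instance (K : Type*) [Field K] (G : Type*) [Group G] : Field (NoetherField K G) :=
  inferInstanceAs (Field (noetherSubfield K G))

theorem algebraMap_mem_noetherSubfield (K : Type*) [Field K] (G : Type*) [Group G] (c : K) :
    algebraMap K (NoetherBigField K G) c ∈ noetherSubfield K G := by
  intro h
  exact AlgEquiv.commutes _ c

instance (K : Type*) [Field K] (G : Type*) [Group G] : Algebra K (NoetherField K G) :=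
  RingHom.toAlgebra <|
    ((algebraMap K (NoetherBigField K G)).codRestrict (noetherSubfield K G).toSubring
      (algebraMap_mem_noetherSubfield K G))

/-- An extension `L/F` is rational (purely transcendental) if `L` is `F`-isomorphic to a
rational function field `F(t₁, …, tₙ)` over `F` in finitely many variables. -/
def IsRationalExtension (F L : Type*) [Field F] [Field L] [Algebra F L] : Prop :=
  ∃ n : ℕ, Nonempty (L ≃ₐ[F] FractionRing (MvPolynomial (Fin n) F))

/-- An extension `L/F` is stably rational if the rational function field `L(y₁, …, y_r)`
is rational over `F` for some finite number `r` of indeterminates. -/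
def IsStablyRationalExtension (F L : Type*) [Field F] [Field L] [Algebra F L] : Prop :=
  ∃ r : ℕ, IsRationalExtension F (FractionRing (MvPolynomial (Fin r) L))

open IntermediateField

theorem nd_exists_trace {K M H : Type*} [Field K] [Field M] [Algebra K M] [Group H] [Fintype H]
    (ρ : H →* (M ≃ₐ[K] M)) (L : IntermediateField K M)
    (hfaith : ∀ h, (∀ x ∈ L, ρ h x = x) → h = 1) (φ : H → M)
    (hφ : ∀ c ∈ L, ∑ h, ρ h c * φ h = 0) : ∀ h, φ h = 0 := by
  let χ : H → (L →* M) := fun h => ((ρ h : M →* M).comp (L.val : L →* M))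
  have hinj : Function.Injective χ := by
    intro h h' e
    have : h'⁻¹ * h = 1 := by
      apply hfaith
      intro x hx
      have := DFunLike.congr_fun e ⟨x, hx⟩
      change ρ h x = ρ h' x at this
      rw [map_mul, AlgEquiv.mul_apply, this, ← AlgEquiv.mul_apply, ← map_mul]
      simp
    exact (inv_mul_eq_one.mp this).symm
  have li := (linearIndependent_monoidHom L M).comp χ hinj
  rw [Fintype.linearIndependent_iff] at li
  apply li φ
  funext c
  have := hφ c.1 c.2
  simp only [Finset.sum_apply, Pi.smul_apply, Function.comp, smul_eq_mul, Pi.zero_apply]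
  rw [← this]
  exact Finset.sum_congr rfl fun h _ => mul_comm _ _

theorem nd_fixed_sup {K M H : Type*} [Field K] [Field M] [Algebra K M] [Group H] [Finite H]
    (ρ : H →* (M ≃ₐ[K] M)) (L F : IntermediateField K M) (Z : Set M)
    (hL : ∀ h, ∀ x ∈ L, ρ h x ∈ L)
    (hfaith : ∀ h, (∀ x ∈ L, ρ h x = x) → h = 1)
    (hZ : ∀ h, ∀ z ∈ Z, ρ h z = z)
    (hF : ∀ x ∈ L, (∀ h, ρ h x = x) → x ∈ F)
    (f : M) (hf : f ∈ L ⊔ adjoin K Z) (hfix : ∀ h, ρ h f = f) : f ∈ F ⊔ adjoin K Z := by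
  have := Fintype.ofFinite H
  classical
  -- invariance of sums
  have hinv : ∀ (x : M) (g : H), ρ g (∑ h, ρ h x) = ∑ h, ρ h x := by
    intro x g
    rw [map_sum]
    simp only [← AlgEquiv.mul_apply, ← map_mul]
    exact Fintype.sum_equiv (Equiv.mulLeft g) _ _ (fun h => rfl)
  have hinvp : ∀ (x : M) (g : H), ρ g (∏ h, ρ h x) = ∏ h, ρ h x := by
    intro x g
    rw [map_prod]
    simp only [← AlgEquiv.mul_apply, ← map_mul]
    exact Fintype.prod_equiv (Equiv.mulLeft g) _ _ (fun h => rfl)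
  obtain ⟨c, hcL, hc⟩ : ∃ c ∈ L, ∑ h, ρ h c = 1 := by
    obtain ⟨c, hcL, hc⟩ : ∃ c ∈ L, ∑ h, ρ h c ≠ 0 := by
      by_contra hcon
      push Not at hcon
      have := nd_exists_trace ρ L hfaith (fun _ => 1) (by simpa using hcon) 1
      exact one_ne_zero this
    refine ⟨c * (∑ h, ρ h c)⁻¹, L.mul_mem hcL (L.inv_mem (L.sum_mem fun h _ => hL h c hcL)), ?_⟩
    simp only [map_mul, map_inv₀, hinv]
    rw [← Finset.sum_mul, mul_inv_cancel₀ hc]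
  have hfixZ : ∀ w ∈ adjoin K Z, ∀ h, ρ h w = w := by
    intro w hw h
    induction hw using adjoin_induction with
    | mem x hx => exact hZ h x hx
    | algebraMap x => exact AlgEquiv.commutes _ x
    | add x y _ _ hx hy => rw [map_add, hx, hy]
    | inv x _ hx => rw [map_inv₀, hx]
    | mul x y _ _ hx hy => rw [map_mul, hx, hy]
  let S : Set M := (L : Set M) ∪ Z
  have hS : L ⊔ adjoin K Z = adjoin K S := by
    rw [adjoin_union, adjoin_self]
  have hmono : ∀ m ∈ Submonoid.closure S, ∃ l ∈ L, ∃ w ∈ adjoin K Z, m = l * w := by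
    intro m hm
    induction hm using Submonoid.closure_induction with
    | mem x hx =>
      rcases hx with hx | hx
      · exact ⟨x, hx, 1, one_mem _, by simp⟩
      · exact ⟨1, one_mem _, x, subset_adjoin K Z hx, by simp⟩
    | one => exact ⟨1, one_mem _, 1, one_mem _, by simp⟩
    | mul x y _ _ hx hy =>
      obtain ⟨l, hl, w, hw, rfl⟩ := hx
      obtain ⟨l', hl', w', hw', rfl⟩ := hy
      exact ⟨l * l', mul_mem hl hl', w * w', mul_mem hw hw', by ring⟩
  have htr : ∀ g ∈ Algebra.adjoin K S, ∑ h, ρ h (c * g) ∈ F ⊔ adjoin K Z := by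
    intro g hg
    rw [← Subalgebra.mem_toSubmodule, Algebra.adjoin_eq_span] at hg
    induction hg using Submodule.span_induction with
    | mem x hx =>
      obtain ⟨l, hl, w, hw, rfl⟩ := hmono x hx
      have : ∑ h, ρ h (c * (l * w)) = (∑ h, ρ h (c * l)) * w := by
        rw [Finset.sum_mul]
        refine Finset.sum_congr rfl fun h _ => ?_
        rw [← mul_assoc, map_mul, hfixZ w hw]
      rw [this]
      refine mul_mem ((le_sup_left : F ≤ _) (hF _ ?_ (hinv _))) ((le_sup_right : adjoin K Z ≤ _) hw)
      exact L.sum_mem fun h _ => hL h _ (mul_mem hcL hl)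
    | zero => simp
    | add x y _ _ hx hy =>
      simp only [mul_add, map_add, Finset.sum_add_distrib]
      exact add_mem hx hy
    | smul a x _ hx =>
      simp only [mul_smul_comm, map_smul]
      rw [← Finset.smul_sum]
      exact (F ⊔ adjoin K Z).smul_mem hx
  have hinvmem : ∀ g ∈ Algebra.adjoin K S, (∀ h, ρ h g = g) → g ∈ F ⊔ adjoin K Z := by
    intro g hg hgf
    have := htr g hg
    simp only [map_mul, hgf] at this
    rwa [← Finset.sum_mul, hc, one_mul] at this
  have hstab : ∀ h, ∀ g ∈ Algebra.adjoin K S, ρ h g ∈ Algebra.adjoin K S := by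
    intro h g hg
    induction hg using Algebra.adjoin_induction with
    | mem x hx =>
      rcases hx with hx | hx
      · exact Algebra.subset_adjoin (Or.inl (hL h x hx))
      · rw [hZ h x hx]; exact Algebra.subset_adjoin (Or.inr hx)
    | algebraMap x => rw [AlgEquiv.commutes]; exact Subalgebra.algebraMap_mem _ x
    | add x y _ _ hx hy => rw [map_add]; exact add_mem hx hy
    | mul x y _ _ hx hy => rw [map_mul]; exact mul_mem hx hy
  rw [hS, mem_adjoin_iff_div] at hf
  obtain ⟨p, hp, q, hq, rfl⟩ := hf
  by_cases hq0 : q = 0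
  · simp [hq0]
  have hQ : ∏ h, ρ h q ∈ Algebra.adjoin K S := prod_mem fun h _ => hstab h q hq
  have hQ0 : ∏ h, ρ h q ≠ 0 := by
    rw [Finset.prod_ne_zero_iff]
    intro h _
    simpa using hq0
  have hP : p / q * ∏ h, ρ h q ∈ Algebra.adjoin K S := by
    rw [← Finset.mul_prod_erase Finset.univ _ (Finset.mem_univ (1 : H))]
    simp only [map_one, AlgEquiv.one_apply]
    rw [← mul_assoc, div_mul_cancel₀ _ hq0]
    exact mul_mem hp (prod_mem fun h _ => hstab h q hq)
  have h1 := hinvmem _ hQ (hinvp q)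
  have h2 := hinvmem _ hP (fun h => by rw [map_mul, hfix, hinvp])
  have := div_mem h2 h1
  rwa [mul_div_assoc, div_self hQ0, mul_one] at this

theorem nd_noname {K M H ι : Type*} [Field K] [Field M] [Algebra K M] [Group H] [Finite H]
    [Fintype ι]
    (ρ : H →* (M ≃ₐ[K] M)) (L : IntermediateField K M) (X : ι → M)
    (hL : ∀ h, ∀ x ∈ L, ρ h x ∈ L)
    (hfaith : ∀ h, (∀ x ∈ L, ρ h x = x) → h = 1)
    (hX : ∀ h i, ρ h (X i) ∈ Set.range X) :
    ∃ Z : Set M, Z.Finite ∧ Z.ncard ≤ Fintype.card ι ∧ (∀ h, ∀ z ∈ Z, ρ h z = z) ∧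
      ∀ i, X i ∈ L ⊔ adjoin K Z := by
  have := Fintype.ofFinite H
  classical
  have hinv : ∀ (x : M) (g : H), ρ g (∑ h, ρ h x) = ∑ h, ρ h x := by
    intro x g
    rw [map_sum]
    simp only [← AlgEquiv.mul_apply, ← map_mul]
    exact Fintype.sum_equiv (Equiv.mulLeft g) _ _ (fun h => rfl)
  let V : Submodule L M := Submodule.span L (Set.range X)
  let Z0 : Set M := {v | v ∈ V ∧ ∀ h, ρ h v = v}
  have hspan : ∀ i, X i ∈ Submodule.span L Z0 := by
    intro i
    by_contra hi
    obtain ⟨φ, hφ, hker⟩ := Submodule.exists_le_ker_of_notMem hi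
    apply hφ
    have := nd_exists_trace ρ L hfaith (fun h => (φ (ρ h (X i)) : M)) ?_ 1
    · simpa using this
    intro c hc
    have hz : ∑ h, ρ h (c * X i) ∈ Z0 := by
      refine ⟨V.sum_mem fun h _ => ?_, hinv _⟩
      rw [map_mul]
      exact V.smul_mem (⟨ρ h c, hL h c hc⟩ : L) (Submodule.subset_span (hX h i))
    have h0 := hker (Submodule.subset_span hz)
    rw [LinearMap.mem_ker, map_sum] at h0
    have h1 := congrArg (fun x : L => (x : M)) h0
    simp only [AddSubmonoidClass.coe_finsetSum, ZeroMemClass.coe_zero] at h1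
    rw [← h1]
    refine Finset.sum_congr rfl fun h _ => ?_
    have : ρ h (c * X i) = (⟨ρ h c, hL h c hc⟩ : L) • ρ h (X i) := by
      rw [map_mul]; rfl
    rw [this, map_smul]; rfl
  obtain ⟨b, hb, hbs, hli⟩ := exists_linearIndependent L Z0
  have hbV : Submodule.span L b ≤ V := by
    rw [hbs, Submodule.span_le]; exact fun v hv => hv.1
  have hfd : FiniteDimensional L V := FiniteDimensional.span_of_finite L (Set.finite_range X)
  have hVb : V = Submodule.span L b := by
    apply le_antisymm _ hbV
    rw [hbs, Submodule.span_le]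
    rintro _ ⟨i, rfl⟩
    exact hspan i
  have hbfin : b.Finite := by
    have : FiniteDimensional L (Submodule.span L b) := hVb ▸ hfd
    have : FiniteDimensional L (Submodule.span L (Set.range (Subtype.val : b → M))) := by
      rwa [Subtype.range_coe]
    exact Set.finite_coe_iff.mp (Module.Finite.finite_basis (Module.Basis.span hli))
  refine ⟨b, hbfin, ?_, fun h z hz => (hb hz).2 h, ?_⟩
  · have := hbfin.fintype
    have e := finrank_span_set_eq_card hli
    rw [Set.ncard_eq_toFinset_card', ← e, ← hVb]
    exact finrank_range_le_card X
  · intro i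
    have : X i ∈ Submodule.span L b := hVb ▸ Submodule.subset_span ⟨i, rfl⟩
    generalize X i = x at this
    induction this using Submodule.span_induction with
    | mem x hx => exact (le_sup_right : adjoin K b ≤ _) (subset_adjoin K b hx)
    | zero => exact zero_mem _
    | add x y _ _ hx hy => exact add_mem hx hy
    | smul a x _ hx =>
      exact mul_mem ((le_sup_left : L ≤ L ⊔ adjoin K b) a.2) hx

theorem nd_swap {K M ι : Type*} [Field K] [Field M] [Algebra K M] [Fintype ι]
    (ω : M ≃ₐ[K] M) (p q : ι → M) (hp : ∀ i, ω (p i) = q i) (hq : ∀ i, ω (q i) = p i) :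
    ∃ s : ι ⊕ ι → M, (∀ i, s i ∈ adjoin K (Set.range p ∪ Set.range q)) ∧ (∀ i, ω (s i) = s i) ∧
      ∀ f ∈ adjoin K (Set.range p ∪ Set.range q), ω f = f → f ∈ adjoin K (Set.range s) := by
  classical
  have hpm : ∀ i, p i ∈ adjoin K (Set.range p ∪ Set.range q) := fun i =>
    subset_adjoin _ _ (Or.inl ⟨i, rfl⟩)
  have hqm : ∀ i, q i ∈ adjoin K (Set.range p ∪ Set.range q) := fun i =>
    subset_adjoin _ _ (Or.inr ⟨i, rfl⟩)
  by_cases hpq : ∀ i, p i = q i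
  · obtain rfl : p = q := funext hpq
    refine ⟨Sum.elim p p, ?_, ?_, ?_⟩
    · rintro (i | i) <;> exact hpm i
    · rintro (i | i) <;> exact hp i
    · intro f hf _
      simpa [Set.Sum.elim_range] using hf
  push Not at hpq
  obtain ⟨o, ho⟩ := hpq
  let s : ι ⊕ ι → M := Sum.elim (fun i => p i + q i)
    (fun i => if i = o then p o * q o else p o * p i + q o * q i)
  have hsω : ∀ i, ω (s i) = s i := by
    rintro (i | i)
    · simp [s, hp, hq, add_comm]
    · by_cases h : i = o
      · simp [s, h, hp, hq, mul_comm]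
      · simp [s, h, hp, hq, add_comm]
  refine ⟨s, ?_, hsω, ?_⟩
  · rintro (i | i)
    · exact add_mem (hpm i) (hqm i)
    · by_cases h : i = o
      · simpa [s, h] using mul_mem (hpm o) (hqm o)
      · simpa [s, h] using add_mem (mul_mem (hpm o) (hpm i)) (mul_mem (hqm o) (hqm i))
  intro f hf hfix
  let F := adjoin K (Set.range s)
  have hFω : ∀ w ∈ F, ω w = w := by
    intro w hw
    induction hw using adjoin_induction with
    | mem x hx => obtain ⟨i, rfl⟩ := hx; exact hsω i
    | algebraMap x => exact AlgEquiv.commutes _ x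
    | add x y _ _ hx hy => rw [map_add, hx, hy]
    | inv x _ hx => rw [map_inv₀, hx]
    | mul x y _ _ hx hy => rw [map_mul, hx, hy]
  have hsF : ∀ i, s i ∈ F := fun i => subset_adjoin _ _ ⟨i, rfl⟩
  have h1 : ∀ i, p i + q i ∈ F := fun i => hsF (Sum.inl i)
  have h2 : p o * q o ∈ F := by simpa [s] using hsF (Sum.inr o)
  have h3 : ∀ i, i ≠ o → p o * p i + q o * q i ∈ F := fun i hi => by
    simpa [s, hi] using hsF (Sum.inr i)
  have hd : p o - q o ≠ 0 := sub_ne_zero.mpr ho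
  -- the F-span of 1, p o
  have hdec : ∀ g ∈ Algebra.adjoin K (Set.range p ∪ Set.range q),
      ∃ a ∈ F, ∃ b ∈ F, g = a + b * p o := by
    have hpi : ∀ i, ∃ a ∈ F, ∃ b ∈ F, p i = a + b * p o := by
      intro i
      by_cases h : i = o
      · exact ⟨0, zero_mem _, 1, one_mem _, by rw [h]; ring⟩
      have hD : (p o + q o) ^ 2 - 4 * (p o * q o) ≠ 0 := by
        have : (p o + q o) ^ 2 - 4 * (p o * q o) = (p o - q o) ^ 2 := by ring
        rw [this]; exact pow_ne_zero 2 hd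
      have hDF : (p o + q o) ^ 2 - 4 * (p o * q o) ∈ F :=
        sub_mem (pow_mem (h1 o) 2) (mul_mem (ofNat_mem F 4) h2)
      -- p i * (p o - q o) = t - q o * e
      refine ⟨((p o + q o) ^ 2 * (p i + q i) - (p o * p i + q o * q i) * (p o + q o)
          - 2 * (p i + q i) * (p o * q o)) / ((p o + q o) ^ 2 - 4 * (p o * q o)), ?_,
          (2 * (p o * p i + q o * q i) - (p o + q o) * (p i + q i)) /
            ((p o + q o) ^ 2 - 4 * (p o * q o)), ?_, ?_⟩
      · exact div_mem (sub_mem (sub_mem (mul_mem (pow_mem (h1 o) 2) (h1 i))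
          (mul_mem (h3 i h) (h1 o))) (mul_mem (mul_mem (ofNat_mem F 2) (h1 i)) h2)) hDF
      · exact div_mem (sub_mem (mul_mem (ofNat_mem F 2) (h3 i h)) (mul_mem (h1 o) (h1 i))) hDF
      · rw [div_mul_eq_mul_div, ← add_div, eq_div_iff hD]
        ring
    have hqi : ∀ i, ∃ a ∈ F, ∃ b ∈ F, q i = a + b * p o := by
      intro i
      obtain ⟨a, ha, b, hb, e⟩ := hpi i
      exact ⟨(p i + q i) - a, sub_mem (h1 i) ha, -b, neg_mem hb, by rw [e]; ring⟩
    intro g hg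
    induction hg using Algebra.adjoin_induction with
    | mem x hx =>
      rcases hx with ⟨i, rfl⟩ | ⟨i, rfl⟩
      · exact hpi i
      · exact hqi i
    | algebraMap x => exact ⟨_, F.algebraMap_mem x, 0, zero_mem _, by ring⟩
    | add x y _ _ hx hy =>
      obtain ⟨a, ha, b, hb, rfl⟩ := hx
      obtain ⟨a', ha', b', hb', rfl⟩ := hy
      exact ⟨a + a', add_mem ha ha', b + b', add_mem hb hb', by ring⟩
    | mul x y _ _ hx hy =>
      obtain ⟨a, ha, b, hb, rfl⟩ := hx
      obtain ⟨a', ha', b', hb', rfl⟩ := hy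
      exact ⟨a * a' - b * b' * (p o * q o),
        sub_mem (mul_mem ha ha') (mul_mem (mul_mem hb hb') h2),
        a * b' + b * a' + b * b' * (p o + q o),
        add_mem (add_mem (mul_mem ha hb') (mul_mem hb ha')) (mul_mem (mul_mem hb hb') (h1 o)),
        by ring⟩
  have hinvmem : ∀ g ∈ Algebra.adjoin K (Set.range p ∪ Set.range q), ω g = g → g ∈ F := by
    intro g hg hgω
    obtain ⟨a, ha, b, hb, rfl⟩ := hdec g hg
    rw [map_add, map_mul, hFω a ha, hFω b hb, hp, add_right_inj] at hgω
    have : b * (p o - q o) = 0 := by rw [mul_sub, hgω, sub_self]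
    rcases mul_eq_zero.mp this with h | h
    · simpa [h] using ha
    · exact absurd h hd
  have hstab : ∀ g ∈ Algebra.adjoin K (Set.range p ∪ Set.range q),
      ω g ∈ Algebra.adjoin K (Set.range p ∪ Set.range q) := by
    intro g hg
    induction hg using Algebra.adjoin_induction with
    | mem x hx =>
      rcases hx with ⟨i, rfl⟩ | ⟨i, rfl⟩
      · rw [hp]; exact Algebra.subset_adjoin (Or.inr ⟨i, rfl⟩)
      · rw [hq]; exact Algebra.subset_adjoin (Or.inl ⟨i, rfl⟩)
    | algebraMap x => rw [AlgEquiv.commutes]; exact Subalgebra.algebraMap_mem _ x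
    | add x y _ _ hx hy => rw [map_add]; exact add_mem hx hy
    | mul x y _ _ hx hy => rw [map_mul]; exact mul_mem hx hy
  have hω2 : ∀ g ∈ Algebra.adjoin K (Set.range p ∪ Set.range q), ω (ω g) = g := by
    intro g hg
    induction hg using Algebra.adjoin_induction with
    | mem x hx =>
      rcases hx with ⟨i, rfl⟩ | ⟨i, rfl⟩
      · rw [hp, hq]
      · rw [hq, hp]
    | algebraMap x => rw [AlgEquiv.commutes, AlgEquiv.commutes]
    | add x y _ _ hx hy => rw [map_add, map_add, hx, hy]
    | mul x y _ _ hx hy => rw [map_mul, map_mul, hx, hy]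
  rw [mem_adjoin_iff_div] at hf
  obtain ⟨r, hr, t, ht, rfl⟩ := hf
  by_cases ht0 : t = 0
  · simp [ht0]
  have hQ0 : t * ω t ≠ 0 := mul_ne_zero ht0 (by simpa using ht0)
  have hQω : ω (t * ω t) = t * ω t := by rw [map_mul, hω2 t ht, mul_comm]
  have hQ := hinvmem (t * ω t) (mul_mem ht (hstab t ht)) hQω
  have hP := hinvmem (r / t * (t * ω t)) (by
    rw [← mul_assoc, div_mul_cancel₀ _ ht0]; exact mul_mem hr (hstab t ht)) (by
    rw [map_mul, hfix, hQω])
  have := div_mem hP hQ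
  rwa [mul_div_assoc, div_self hQ0, mul_one] at this

open MvPolynomial in
/-- The variable `x i` in the rational function field. -/
def ndX (K : Type*) [Field K] {ι : Type*} (i : ι) : NoetherBigField K ι :=
  algebraMap (MvPolynomial ι K) _ (MvPolynomial.X i)

theorem ndX_injective (K : Type*) [Field K] {ι : Type*} :
    Function.Injective (ndX K : ι → NoetherBigField K ι) := by
  intro i j h
  exact MvPolynomial.X_injective (IsFractionRing.injective (MvPolynomial ι K) _ h)

theorem nd_top (K : Type*) [Field K] (ι : Type*) :
    adjoin K (Set.range (ndX K : ι → NoetherBigField K ι)) = ⊤ := by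
  rw [eq_top_iff]
  intro f _
  have hp : ∀ p : MvPolynomial ι K, algebraMap (MvPolynomial ι K) (NoetherBigField K ι) p ∈
      adjoin K (Set.range (ndX K : ι → NoetherBigField K ι)) := by
    intro p
    induction p using MvPolynomial.induction_on with
    | C a =>
      have : algebraMap (MvPolynomial ι K) (NoetherBigField K ι) (MvPolynomial.C a)
        = algebraMap K _ a := (IsScalarTower.algebraMap_apply K (MvPolynomial ι K) _ a).symm
      rw [this]; exact IntermediateField.algebraMap_mem _ a
    | add p q hp hq => rw [map_add]; exact add_mem hp hq
    | mul_X p i hp => rw [map_mul]; exact mul_mem hp (subset_adjoin _ _ ⟨i, rfl⟩)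
  obtain ⟨p, q, _, rfl⟩ := IsFractionRing.div_surjective (A := MvPolynomial ι K) f
  exact div_mem (hp p) (hp q)

theorem nd_hom_ext {K ι A : Type*} [Field K] [Field A] [Algebra K A]
    (f g : NoetherBigField K ι →ₐ[K] A) (h : ∀ i, f (ndX K i) = g (ndX K i)) (x) : f x = g x := by
  have hx : x ∈ adjoin K (Set.range (ndX K : ι → NoetherBigField K ι)) := by
    rw [nd_top]; trivial
  induction hx using adjoin_induction with
  | mem x hx => obtain ⟨i, rfl⟩ := hx; exact h i
  | algebraMap x => simp
  | add x y _ _ hx hy => rw [map_add, map_add, hx, hy]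
  | inv x _ hx => rw [map_inv₀, map_inv₀, hx]
  | mul x y _ _ hx hy => rw [map_mul, map_mul, hx, hy]

/-- The automorphism induced by a permutation of variables. -/
def ndPermAut (K : Type*) [Field K] {ι : Type*} (π : Equiv.Perm ι) :
    NoetherBigField K ι ≃ₐ[K] NoetherBigField K ι :=
  IsFractionRing.algEquivOfAlgEquiv (MvPolynomial.renameEquiv K π)

theorem ndPermAut_X (K : Type*) [Field K] {ι : Type*} (π : Equiv.Perm ι) (i : ι) :
    ndPermAut K π (ndX K i) = ndX K (π i) := by
  unfold ndPermAut ndX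
  rw [IsFractionRing.algEquivOfAlgEquiv_algebraMap]
  simp

theorem noetherAut_X (K : Type*) [Field K] {G : Type*} [Group G] (h g : G) :
    noetherAut K G h (ndX K g) = ndX K (h * g) := ndPermAut_X K (Equiv.mulLeft h) g

/-- The action of permutations on the rational function field. -/
def ndPermHom (K : Type*) [Field K] (ι : Type*) :
    Equiv.Perm ι →* (NoetherBigField K ι ≃ₐ[K] NoetherBigField K ι) where
  toFun := ndPermAut K
  map_one' := by
    ext x
    exact nd_hom_ext (ndPermAut K (1 : Equiv.Perm ι)).toAlgHom (AlgHom.id K _)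
      (fun i => by simp [ndPermAut_X]) x
  map_mul' π π' := by
    ext x
    exact nd_hom_ext (ndPermAut K (π * π')).toAlgHom
      ((ndPermAut K π).toAlgHom.comp (ndPermAut K π').toAlgHom)
      (fun i => by simp [ndPermAut_X]) x

theorem ndEmb_inj (K : Type*) [Field K] {ι ι' : Type*} (j : ι' → ι) (hj : Function.Injective j) :
    Function.Injective ((IsScalarTower.toAlgHom K (MvPolynomial ι K) (NoetherBigField K ι)).comp
      (MvPolynomial.rename j)) :=
  (IsFractionRing.injective (MvPolynomial ι K) (NoetherBigField K ι)).comp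
      (MvPolynomial.rename_injective j hj)

/-- The embedding of rational function fields induced by an injection of variables. -/
def ndEmb (K : Type*) [Field K] {ι ι' : Type*} (j : ι' → ι) (hj : Function.Injective j) :
    NoetherBigField K ι' →ₐ[K] NoetherBigField K ι :=
  IsFractionRing.liftAlgHom (A := MvPolynomial ι' K)
    (g := (IsScalarTower.toAlgHom K (MvPolynomial ι K) (NoetherBigField K ι)).comp
      (MvPolynomial.rename j))
    (ndEmb_inj K j hj)

theorem ndEmb_X (K : Type*) [Field K] {ι ι' : Type*} (j : ι' → ι) (hj : Function.Injective j)
    (i : ι') : ndEmb K j hj (ndX K i) = ndX K (j i) := by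
  refine (IsFractionRing.lift_algebraMap (ndEmb_inj K j hj) _).trans ?_
  simp [ndX]

theorem nd_trdeg (K : Type*) [Field K] (ι : Type) [Fintype ι] :
    Algebra.trdeg K (NoetherBigField K ι) = (Fintype.card ι : Cardinal) := by
  have : Algebra.IsAlgebraic (MvPolynomial ι K) (NoetherBigField K ι) :=
    IsLocalization.isAlgebraic _ (nonZeroDivisors (MvPolynomial ι K))
  have h := (IsTranscendenceBasis.mvPolynomial ι K).algebraMap_comp (A := NoetherBigField K ι)
  have := h.lift_cardinalMk_eq_trdeg
  simpa using this.symm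

theorem nd_final {K N M : Type*} [Field K] [Field N] [Field M] [Algebra K N] [Algebra N M]
    [Algebra K M] [IsScalarTower K N M] {α β : Type*} [Fintype α] [Fintype β]
    (t : α → M) (s : β → M)
    (ht : AlgebraicIndependent N t) (hs : AlgebraicIndependent K s)
    (h : ∀ f, f ∈ adjoin N (Set.range t) ↔ f ∈ adjoin K (Set.range s)) :
    IsStablyRationalExtension K N := by
  let ea := (Fintype.equivFin α).symm
  let eb := (Fintype.equivFin β).symm
  have ht' := ht.comp ea ea.injective
  have hs' := hs.comp eb eb.injective
  have hre : (adjoin N (Set.range (t ∘ ea))).restrictScalars K = adjoin K (Set.range (s ∘ eb)) := by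
    ext f
    rw [mem_restrictScalars, ea.surjective.range_comp, eb.surjective.range_comp]
    exact h f
  exact ⟨Fintype.card α, Fintype.card β, ⟨(ht'.aevalEquivField.restrictScalars K).trans
      ((IntermediateField.equivOfEq hre).trans hs'.aevalEquivField.symm)⟩⟩

open scoped IntermediateField.algebraAdjoinAdjoin in
theorem nd_isAlgebraic {K F M H ι : Type*} [Field K] [Field F] [Field M] [Algebra K M]
    [Algebra F M] [Group H] [Finite H] (ρ : H →* (M ≃ₐ[K] M)) (t : ι → M)
    (ht : ∀ f, (∀ h, ρ h f = f) → f ∈ adjoin F (Set.range t)) :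
    Algebra.IsAlgebraic (Algebra.adjoin F (Set.range t)) M := by
  let : MulSemiringAction H M := MulSemiringAction.compHom M ρ
  let Fx := FixedPoints.subfield H M
  have h1 : Algebra.IsAlgebraic Fx M := inferInstance
  have hle : Fx ≤ (adjoin F (Set.range t)).toSubfield := fun f hf => ht f hf
  let : Algebra Fx (adjoin F (Set.range t)) := (Subfield.inclusion hle).toAlgebra
  have : IsScalarTower Fx (adjoin F (Set.range t)) M := IsScalarTower.of_algebraMap_eq fun _ => rfl
  have h2 : Algebra.IsAlgebraic (adjoin F (Set.range t)) M := Algebra.IsAlgebraic.tower_top (K := Fx) _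
  exact (IsFractionRing.comap_isAlgebraic_iff (A := Algebra.adjoin F (Set.range t))
    (K := adjoin F (Set.range t)) (C := M)).mpr h2

theorem nd_indep {K F M H : Type*} {ι : Type} [Field K] [Field F] [Field M] [Algebra K M]
    [Algebra F M] [Group H] [Finite H] [Fintype ι] (ρ : H →* (M ≃ₐ[K] M)) (t : ι → M)
    (ht : ∀ f, (∀ h, ρ h f = f) → f ∈ adjoin F (Set.range t))
    (hc : (Fintype.card ι : Cardinal) ≤ Algebra.trdeg F M) :
    AlgebraicIndependent F t := by
  have := nd_isAlgebraic ρ t ht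
  refine (Algebra.IsAlgebraic.isTranscendenceBasis_of_lift_le_trdeg_of_finite F t ?_).1
  have := Cardinal.lift_le.{0}.mpr hc
  simpa using this

theorem nd_cyc {K : Type*} [Field K] {G : Type} [Group G] [Fintype G]
    (h : IsRationalExtension K (NoetherField K G)) :
    ∃ m ≤ Fintype.card G, ∃ u : Fin m → NoetherBigField K G,
      (∀ g i, noetherAut K G g (u i) = u i) ∧
      ∀ f, (∀ g, noetherAut K G g f = f) → f ∈ adjoin K (Set.range u) := by
  obtain ⟨m, ⟨e⟩⟩ := h
  let v : NoetherField K G →ₐ[K] NoetherBigField K G :=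
    { (noetherSubfield K G).subtype with commutes' := fun _ => rfl }
  have hv : Function.Injective v := v.toRingHom.injective
  let w : NoetherBigField K (Fin m) →ₐ[K] NoetherBigField K G := v.comp e.symm
  refine ⟨m, ?_, fun i => w (ndX K i), ?_, ?_⟩
  · have := lift_trdeg_le_of_injective w w.toRingHom.injective
    rw [nd_trdeg, nd_trdeg] at this
    simpa using this
  · intro g i
    exact (e.symm (ndX K i)).2 g
  · intro f hf
    have : f = w (e ⟨f, hf⟩) := by
      simp only [w, AlgHom.comp_apply]
      erw [AlgEquiv.symm_apply_apply]
      rfl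
    rw [this]
    have h2 : e ⟨f, hf⟩ ∈ adjoin K (Set.range (ndX K : Fin m → _)) := by rw [nd_top]; trivial
    have h3 : w (e ⟨f, hf⟩) ∈ (adjoin K (Set.range (ndX K : Fin m → _))).map w := ⟨_, h2, rfl⟩
    rw [adjoin_map, ← Set.range_comp] at h3
    exact h3

/-- Index set of the variables `x_d, y_c, a_c, b_c`. -/
inductive NdI (n : ℕ) : Type
  | x : DihedralGroup n → NdI n
  | y : Multiplicative (ZMod n) → NdI n
  | a : Multiplicative (ZMod n) → NdI n
  | b : Multiplicative (ZMod n) → NdI n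

/-- The indices as a sum type. -/
def ndIEquiv (n : ℕ) : (DihedralGroup n ⊕ Multiplicative (ZMod n)) ⊕
    (Multiplicative (ZMod n) ⊕ Multiplicative (ZMod n)) ≃ NdI n where
  toFun := Sum.elim (Sum.elim NdI.x NdI.y) (Sum.elim NdI.a NdI.b)
  invFun
    | .x d => .inl (.inl d)
    | .y c => .inl (.inr c)
    | .a c => .inr (.inl c)
    | .b c => .inr (.inr c)
  left_inv := by rintro ((_ | _) | (_ | _)) <;> rfl
  right_inv := by rintro (_ | _ | _ | _) <;> rfl

/-- The group `C_n × D_n`. -/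
abbrev NdG (n : ℕ) : Type := Multiplicative (ZMod n) × DihedralGroup n

/-- The action on indices. -/
def ndAct {n : ℕ} : NdG n → NdI n → NdI n
  | (_, d), .x d' => .x (d * d')
  | (c, _), .y c' => .y (c * c')
  | (c, .r k), .a c' => .a (c * Multiplicative.ofAdd k * c')
  | (c, .sr k), .a c' => .b (c * Multiplicative.ofAdd k * c')
  | (c, .r k), .b c' => .b (c * (Multiplicative.ofAdd k)⁻¹ * c')
  | (c, .sr k), .b c' => .a (c * (Multiplicative.ofAdd k)⁻¹ * c')

instance (n : ℕ) : MulAction (NdG n) (NdI n) where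
  smul := ndAct
  one_smul := by
    rintro (d | c | c | c)
    · exact congrArg NdI.x (one_mul d)
    · exact congrArg NdI.y (one_mul c)
    · change NdI.a (1 * Multiplicative.ofAdd (0 : ZMod n) * c) = _
      simp
    · change NdI.b (1 * (Multiplicative.ofAdd (0 : ZMod n))⁻¹ * c) = _
      simp
  mul_smul := by
    intro g g' i
    change ndAct _ _ = ndAct _ (ndAct _ _)
    rcases i with d | e | e | e
    · exact congrArg NdI.x (mul_assoc _ _ _)
    · exact congrArg NdI.y (mul_assoc _ _ _)
    · obtain ⟨c, (k | k)⟩ := g <;> obtain ⟨c', (k' | k')⟩ := g' <;>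
      simp [ndAct, mul_assoc, sub_eq_add_neg, mul_left_comm, mul_comm]
    · obtain ⟨c, (k | k)⟩ := g <;> obtain ⟨c', (k' | k')⟩ := g' <;>
      simp [ndAct, mul_assoc, sub_eq_add_neg, mul_left_comm, mul_comm]

/-- The action on the function field. -/
def ndρ (K : Type*) [Field K] (n : ℕ) :
    NdG n →* (NoetherBigField K (NdI n) ≃ₐ[K] NoetherBigField K (NdI n)) :=
  (ndPermHom K (NdI n)).comp (MulAction.toPermHom (NdG n) (NdI n))

theorem ndρ_X (K : Type*) [Field K] (n : ℕ) (g : NdG n) (i : NdI n) :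
    ndρ K n g (ndX K i) = ndX K (ndAct g i) := ndPermAut_X K _ i

section
variable (K : Type*) [Field K] (n : ℕ)

/-- embedding of the `x` variables -/
def ndEx : NoetherBigField K (DihedralGroup n) →ₐ[K] NoetherBigField K (NdI n) :=
  ndEmb K NdI.x (fun _ _ h => NdI.x.inj h)
/-- embedding of the `y` variables -/
def ndEy : NoetherBigField K (Multiplicative (ZMod n)) →ₐ[K] NoetherBigField K (NdI n) :=
  ndEmb K NdI.y (fun _ _ h => NdI.y.inj h)
/-- embedding of the `a` variables -/
def ndEa : NoetherBigField K (Multiplicative (ZMod n)) →ₐ[K] NoetherBigField K (NdI n) :=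
  ndEmb K NdI.a (fun _ _ h => NdI.a.inj h)
/-- embedding of the `b` variables -/
def ndEb : NoetherBigField K (Multiplicative (ZMod n)) →ₐ[K] NoetherBigField K (NdI n) :=
  ndEmb K NdI.b (fun _ _ h => NdI.b.inj h)

theorem ndEx_X (d) : ndEx K n (ndX K d) = ndX K (NdI.x d) := ndEmb_X K _ _ d
theorem ndEy_X (d) : ndEy K n (ndX K d) = ndX K (NdI.y d) := ndEmb_X K _ _ d
theorem ndEa_X (d) : ndEa K n (ndX K d) = ndX K (NdI.a d) := ndEmb_X K _ _ d
theorem ndEb_X (d) : ndEb K n (ndX K d) = ndX K (NdI.b d) := ndEmb_X K _ _ d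

theorem nd_equiv {K ι B : Type*} [Field K] [Field B] [Algebra K B]
    (e e' : NoetherBigField K ι →ₐ[K] B) (σ : B ≃ₐ[K] B)
    (τ : NoetherBigField K ι ≃ₐ[K] NoetherBigField K ι)
    (h : ∀ i, σ (e (ndX K i)) = e' (τ (ndX K i))) (f) : σ (e f) = e' (τ f) :=
  nd_hom_ext (σ.toAlgHom.comp e) (e'.comp τ.toAlgHom) h f

theorem noetherAut_one {K G : Type*} [Field K] [Group G] (f) : noetherAut K G 1 f = f :=
  nd_hom_ext (noetherAut K G 1).toAlgHom (AlgHom.id K _) (fun i => by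
    change noetherAut K G 1 _ = _
    rw [noetherAut_X, one_mul]; rfl) f

theorem ndρ_x (g : NdG n) (f) : ndρ K n g (ndEx K n f) = ndEx K n (noetherAut K _ g.2 f) := by
  apply nd_equiv
  intro i
  rw [ndEx_X, ndρ_X, noetherAut_X, ndEx_X]
  rfl

theorem ndρ_y (g : NdG n) (f) : ndρ K n g (ndEy K n f) = ndEy K n (noetherAut K _ g.1 f) := by
  apply nd_equiv
  intro i
  rw [ndEy_X, ndρ_X, noetherAut_X, ndEy_X]
  rfl

theorem ndρ_ar (c) (k) (f) : ndρ K n (c, .r k) (ndEa K n f) = ndEa K n (noetherAut K _ (c * Multiplicative.ofAdd k) f) := by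
  apply nd_equiv
  intro i
  rw [ndEa_X, ndρ_X, noetherAut_X, ndEa_X]
  rfl

theorem ndρ_br (c) (k) (f) : ndρ K n (c, .r k) (ndEb K n f) = ndEb K n (noetherAut K _ (c * (Multiplicative.ofAdd k)⁻¹) f) := by
  apply nd_equiv
  intro i
  rw [ndEb_X, ndρ_X, noetherAut_X, ndEb_X]
  rfl

theorem ndρ_as (c) (k) (f) : ndρ K n (c, .sr k) (ndEa K n f) = ndEb K n (noetherAut K _ (c * Multiplicative.ofAdd k) f) := by
  apply nd_equiv
  intro i
  rw [ndEa_X, ndρ_X, noetherAut_X, ndEb_X]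
  rfl

theorem ndρ_bs (c) (k) (f) : ndρ K n (c, .sr k) (ndEb K n f) = ndEa K n (noetherAut K _ (c * (Multiplicative.ofAdd k)⁻¹) f) := by
  apply nd_equiv
  intro i
  rw [ndEb_X, ndρ_X, noetherAut_X, ndEa_X]
  rfl

theorem ndX_mem_x (d) : ndX K (NdI.x d : NdI n) ∈ (ndEx K n).fieldRange :=
  ⟨ndX K d, ndEmb_X K _ _ d⟩
theorem ndX_mem_y (d) : ndX K (NdI.y d : NdI n) ∈ (ndEy K n).fieldRange :=
  ⟨ndX K d, ndEmb_X K _ _ d⟩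
theorem ndX_mem_a (d) : ndX K (NdI.a d : NdI n) ∈ (ndEa K n).fieldRange :=
  ⟨ndX K d, ndEmb_X K _ _ d⟩
theorem ndX_mem_b (d) : ndX K (NdI.b d : NdI n) ∈ (ndEb K n).fieldRange :=
  ⟨ndX K d, ndEmb_X K _ _ d⟩

end

/-- stability of a sup from the two pieces -/
theorem nd_sup_stab {K M : Type*} [Field K] [Field M] [Algebra K M] (σ : M ≃ₐ[K] M)
    (L₁ L₂ : IntermediateField K M) (h₁ : ∀ x ∈ L₁, σ x ∈ L₁ ⊔ L₂) (h₂ : ∀ x ∈ L₂, σ x ∈ L₁ ⊔ L₂)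
    (x : M) (hx : x ∈ L₁ ⊔ L₂) : σ x ∈ L₁ ⊔ L₂ := by
  have : L₁ ⊔ L₂ ≤ (L₁ ⊔ L₂).comap σ.toAlgHom :=
    sup_le (fun x hx => h₁ x hx) (fun x hx => h₂ x hx)
  exact this hx

theorem nd_map_mem {K A M ι : Type*} [Field K] [Field A] [Field M] [Algebra K A] [Algebra K M]
    (e : A →ₐ[K] M) (u : ι → A) (f : A) (hf : f ∈ adjoin K (Set.range u)) :
    e f ∈ adjoin K (Set.range (fun i => e (u i))) := by
  have h3 : e f ∈ (adjoin K (Set.range u)).map e := ⟨_, hf, rfl⟩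
  rw [adjoin_map, ← Set.range_comp] at h3
  exact h3

theorem nd_sup_eq_top (K : Type*) [Field K] (n : ℕ) (L : IntermediateField K (NoetherBigField K (NdI n)))
    (h : ∀ i, ndX K i ∈ L) (f) : f ∈ L := by
  have : (⊤ : IntermediateField K (NoetherBigField K (NdI n))) ≤ L := by
    rw [← nd_top, adjoin_le_iff]
    rintro _ ⟨i, rfl⟩
    exact h i
  exact this trivial

/-- invariants in the `x, y` part -/
theorem nd_fix_xy (K : Type*) [Field K] (n : ℕ) [NeZero n] {m : ℕ}
    (u : Fin m → NoetherBigField K (Multiplicative (ZMod n)))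
    (hu : ∀ g i, noetherAut K _ g (u i) = u i)
    (hu' : ∀ f, (∀ g, noetherAut K _ g f = f) → f ∈ adjoin K (Set.range u))
    (f) (hf : f ∈ (ndEx K n).fieldRange ⊔ (ndEy K n).fieldRange) (hfix : ∀ g, ndρ K n g f = f) :
    f ∈ adjoin K (ndEx K n '' (noetherSubfield K (DihedralGroup n))) ⊔
      adjoin K (Set.range (fun i => ndEy K n (u i))) := by
  have s1 := nd_fixed_sup ((ndρ K n).comp (MonoidHom.inl _ _)) (ndEy K n).fieldRange
    (adjoin K (Set.range (fun i => ndEy K n (u i)))) ((ndEx K n).fieldRange : Set _)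
    (by
      rintro h _ ⟨x, rfl⟩
      exact ⟨_, (ndρ_y K n (h, 1) x).symm⟩)
    (by
      intro h hh
      have := hh _ (ndX_mem_y K n 1)
      erw [ndρ_X] at this
      have := ndX_injective K this
      simpa [ndAct] using this)
    (by
      rintro h _ ⟨x, rfl⟩
      refine (ndρ_x K n (h, 1) x).trans ?_
      exact congrArg (ndEx K n) (noetherAut_one x))
    (by
      rintro _ ⟨x, rfl⟩ hx
      apply nd_map_mem
      apply hu'
      intro g
      exact (ndEy K n).toRingHom.injective ((ndρ_y K n (g, 1) x).symm.trans (hx g)))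
    f (by rwa [adjoin_self, sup_comm]) (fun h => hfix _)
  rw [adjoin_self, sup_comm] at s1
  exact nd_fixed_sup ((ndρ K n).comp (MonoidHom.inr _ _)) (ndEx K n).fieldRange
    (adjoin K (ndEx K n '' (noetherSubfield K (DihedralGroup n)))) _
    (by
      rintro h _ ⟨x, rfl⟩
      exact ⟨_, (ndρ_x K n (1, h) x).symm⟩)
    (by
      intro h hh
      have := hh _ (ndX_mem_x K n 1)
      erw [ndρ_X] at this
      have := ndX_injective K this
      simpa [ndAct] using this)
    (by
      rintro h _ ⟨i, rfl⟩
      refine (ndρ_y K n (1, h) _).trans ?_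
      rw [hu])
    (by
      rintro _ ⟨x, rfl⟩ hx
      refine subset_adjoin _ _ ⟨x, ?_, rfl⟩
      intro g
      exact (ndEx K n).toRingHom.injective ((ndρ_x K n (1, g) x).symm.trans (hx g)))
    f s1 (fun h => hfix _)

/-- The homomorphism `C_n → C_n × D_n` acting only on the `a`-variables. -/
def ndHomA (n : ℕ) (h : ZMod n) : Multiplicative (ZMod n) →* NdG n where
  toFun s := (Multiplicative.ofAdd (h * s.toAdd), .r (h * s.toAdd))
  map_one' := by simp
  map_mul' s t := by simp [mul_add]

/-- The homomorphism `C_n → C_n × D_n` acting only on the `b`-variables. -/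
def ndHomB (n : ℕ) (h : ZMod n) : Multiplicative (ZMod n) →* NdG n where
  toFun s := (Multiplicative.ofAdd (h * s.toAdd), .r (-(h * s.toAdd)))
  map_one' := by simp
  map_mul' s t := by simp [mul_add, add_comm]


theorem ndHomA_a (K : Type*) [Field K] (n : ℕ) (h : ZMod n) (hh : h + h = 1) (s f) : ndρ K n (ndHomA n h s) (ndEa K n f) = ndEa K n (noetherAut K _ s f) := by
  refine (ndρ_ar K n _ _ f).trans ?_
  rw [← ofAdd_add, ← add_mul, hh, one_mul, ofAdd_toAdd]

theorem ndHomA_b (K : Type*) [Field K] (n : ℕ) (h : ZMod n) (hh : h + h = 1) (s f) : ndρ K n (ndHomA n h s) (ndEb K n f) = ndEb K n f := by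
  refine (ndρ_br K n _ _ f).trans ?_
  rw [mul_inv_cancel, noetherAut_one]

theorem ndHomB_b (K : Type*) [Field K] (n : ℕ) (h : ZMod n) (hh : h + h = 1) (s f) : ndρ K n (ndHomB n h s) (ndEb K n f) = ndEb K n (noetherAut K _ s f) := by
  refine (ndρ_br K n _ _ f).trans ?_
  rw [ofAdd_neg, inv_inv, ← ofAdd_add, ← add_mul, hh, one_mul, ofAdd_toAdd]

theorem ndHomB_a (K : Type*) [Field K] (n : ℕ) (h : ZMod n) (hh : h + h = 1) (s f) : ndρ K n (ndHomB n h s) (ndEa K n f) = ndEa K n f := by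
  refine (ndρ_ar K n _ _ f).trans ?_
  rw [ofAdd_neg, mul_inv_cancel, noetherAut_one]

theorem nd_faith_ab (n : ℕ) (h : ZMod n) (hh : h + h = 1) (g : NdG n) (hg : ∀ c, ndAct g (.a c) = .a c) (hg' : ∀ c, ndAct g (.b c) = .b c) :
    g = 1 := by
  obtain ⟨c, (k | k)⟩ := g
  · have h1 := NdI.a.inj (hg 1)
    have h2 := NdI.b.inj (hg' 1)
    rw [mul_one] at h1 h2
    have h3 : c = Multiplicative.ofAdd k := mul_inv_eq_one.mp h2
    rw [h3, ← ofAdd_add] at h1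
    have h4 : k + k = 0 := h1
    have h5 : k = 0 := by
      have : k = h * (k + k) := by rw [mul_add, ← add_mul, hh, one_mul]
      rw [this, h4, mul_zero]
    rw [h3, h5]; rfl
  · exact absurd (hg 1) (fun e => by cases e)

theorem nd_fix_ab (K : Type*) [Field K] (n : ℕ) [NeZero n] (h : ZMod n) (hh : h + h = 1) {m : ℕ}
    (u : Fin m → NoetherBigField K (Multiplicative (ZMod n)))
    (hu : ∀ g i, noetherAut K _ g (u i) = u i)
    (hu' : ∀ f, (∀ g, noetherAut K _ g f = f) → f ∈ adjoin K (Set.range u))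
    (f) (hf : f ∈ (ndEa K n).fieldRange ⊔ (ndEb K n).fieldRange) (hfix : ∀ g, ndρ K n g f = f) :
    f ∈ adjoin K (Set.range (fun i => ndEa K n (u i)) ∪ Set.range (fun i => ndEb K n (u i))) := by
  have s1 := nd_fixed_sup ((ndρ K n).comp (ndHomA n h)) (ndEa K n).fieldRange
    (adjoin K (Set.range (fun i => ndEa K n (u i)))) ((ndEb K n).fieldRange : Set _)
    (by
      rintro s _ ⟨x, rfl⟩
      exact ⟨_, (ndHomA_a K n h hh s x).symm⟩)
    (by
      intro s hs
      have := (ndHomA_a K n h hh s _).symm.trans (hs _ ⟨ndX K 1, rfl⟩)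
      have := (ndEa K n).toRingHom.injective this
      rw [noetherAut_X] at this
      simpa using ndX_injective K this)
    (by
      rintro s _ ⟨x, rfl⟩
      exact ndHomA_b K n h hh s x)
    (by
      rintro _ ⟨x, rfl⟩ hx
      apply nd_map_mem
      apply hu'
      intro g
      exact (ndEa K n).toRingHom.injective ((ndHomA_a K n h hh g x).symm.trans (hx g)))
    f (by rwa [adjoin_self]) (fun h => hfix _)
  rw [adjoin_self, sup_comm] at s1
  rw [adjoin_union, sup_comm]
  exact nd_fixed_sup ((ndρ K n).comp (ndHomB n h)) (ndEb K n).fieldRange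
    (adjoin K (Set.range (fun i => ndEb K n (u i)))) _
    (by
      rintro s _ ⟨x, rfl⟩
      exact ⟨_, (ndHomB_b K n h hh s x).symm⟩)
    (by
      intro s hs
      have := (ndHomB_b K n h hh s _).symm.trans (hs _ ⟨ndX K 1, rfl⟩)
      have := (ndEb K n).toRingHom.injective this
      rw [noetherAut_X] at this
      simpa using ndX_injective K this)
    (by
      rintro s _ ⟨i, rfl⟩
      exact ndHomB_a K n h hh s _)
    (by
      rintro _ ⟨x, rfl⟩ hx
      apply nd_map_mem
      apply hu'
      intro g
      exact (ndEb K n).toRingHom.injective ((ndHomB_b K n h hh g x).symm.trans (hx g)))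
    f s1 (fun h => hfix _)

/-- Elements fixed by all of the group form an intermediate field. -/
theorem nd_fixed_adjoin {K M H : Type*} [Field K] [Field M] [Algebra K M] [Group H]
    (ρ : H →* (M ≃ₐ[K] M)) (S : Set M) (hS : ∀ s ∈ S, ∀ h, ρ h s = s) (f) (hf : f ∈ adjoin K S) (h) :
    ρ h f = f := by
  induction hf using adjoin_induction with
  | mem x hx => exact hS x hx h
  | algebraMap x => exact AlgEquiv.commutes _ x
  | add x y _ _ hx hy => rw [map_add, hx, hy]
  | inv x _ hx => rw [map_inv₀, hx]
  | mul x y _ _ hx hy => rw [map_mul, hx, hy]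

instance (n : ℕ) [NeZero n] : Fintype (NdI n) := Fintype.ofEquiv _ (ndIEquiv n)

theorem nd_card (n : ℕ) [NeZero n] : Fintype.card (NdI n) = 5 * n := by
  rw [← Fintype.card_congr (ndIEquiv n)]
  simp only [Fintype.card_sum, DihedralGroup.card, Fintype.card_multiplicative, ZMod.card]
  ring

/-- no-name lemma plus descent -/
theorem nd_combo {K M H ι : Type*} [Field K] [Field M] [Algebra K M] [Group H] [Finite H]
    [Fintype ι]
    (ρ : H →* (M ≃ₐ[K] M)) (L F : IntermediateField K M) (X : ι → M)
    (hL : ∀ h, ∀ x ∈ L, ρ h x ∈ L)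
    (hfaith : ∀ h, (∀ x ∈ L, ρ h x = x) → h = 1)
    (hX : ∀ h i, ∃ j, ρ h (X i) = X j)
    (hF : ∀ x ∈ L, (∀ h, ρ h x = x) → x ∈ F)
    (htop : ∀ L' : IntermediateField K M, L ≤ L' → (∀ i, X i ∈ L') → ∀ f, f ∈ L') :
    ∃ Z : Set M, Z.Finite ∧ Z.ncard ≤ Fintype.card ι ∧ (∀ z ∈ Z, ∀ h, ρ h z = z) ∧
      ∀ f, (∀ h, ρ h f = f) → f ∈ F ⊔ adjoin K Z := by
  obtain ⟨Z, hZf, hZc, hZfix, hZ⟩ := nd_noname ρ L X hL hfaith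
    (fun h i => by obtain ⟨j, hj⟩ := hX h i; exact ⟨j, hj.symm⟩)
  exact ⟨Z, hZf, hZc, fun z hz h => hZfix h z hz, fun f hf =>
    nd_fixed_sup ρ L F Z hL hfaith hZfix hF f (htop _ le_sup_left hZ f) hf⟩

/-- first description of the invariants -/
theorem nd_desc1 (K : Type*) [Field K] (n : ℕ) [NeZero n] {m : ℕ}
    (u : Fin m → NoetherBigField K (Multiplicative (ZMod n)))
    (hu : ∀ g i, noetherAut K _ g (u i) = u i)
    (hu' : ∀ f, (∀ g, noetherAut K _ g f = f) → f ∈ adjoin K (Set.range u)) :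
    ∃ Z : Set (NoetherBigField K (NdI n)), Z.Finite ∧ Z.ncard ≤ 2 * n ∧
      (∀ z ∈ Z, ∀ g, ndρ K n g z = z) ∧ ∀ f, (∀ g, ndρ K n g f = f) →
      f ∈ adjoin K (ndEx K n '' (noetherSubfield K (DihedralGroup n))) ⊔
      adjoin K (Set.range (fun i => ndEy K n (u i))) ⊔ adjoin K Z := by
  have hL : ∀ g, ∀ x ∈ (ndEx K n).fieldRange ⊔ (ndEy K n).fieldRange,
      ndρ K n g x ∈ (ndEx K n).fieldRange ⊔ (ndEy K n).fieldRange := by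
    intro g
    apply nd_sup_stab
    · rintro _ ⟨x, rfl⟩
      exact (le_sup_left : _ ≤ (ndEx K n).fieldRange ⊔ _) ⟨_, (ndρ_x K n g x).symm⟩
    · rintro _ ⟨x, rfl⟩
      exact (le_sup_right : (ndEy K n).fieldRange ≤ _) ⟨_, (ndρ_y K n g x).symm⟩
  have hfaith : ∀ g, (∀ x ∈ (ndEx K n).fieldRange ⊔ (ndEy K n).fieldRange,
      ndρ K n g x = x) → g = 1 := by
    intro g hg
    have h1 := hg _ ((le_sup_left : _ ≤ (ndEx K n).fieldRange ⊔ _) (ndX_mem_x K n 1))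
    have h2 := hg _ ((le_sup_right : (ndEy K n).fieldRange ≤ _) (ndX_mem_y K n 1))
    rw [ndρ_X] at h1 h2
    have h1 := NdI.x.inj (ndX_injective K h1)
    have h2 := NdI.y.inj (ndX_injective K h2)
    rw [mul_one] at h1 h2
    exact Prod.ext h2 h1
  have key := nd_combo (ι := Multiplicative (ZMod n) ⊕ Multiplicative (ZMod n)) (ndρ K n)
    ((ndEx K n).fieldRange ⊔ (ndEy K n).fieldRange)
    (adjoin K (ndEx K n '' (noetherSubfield K (DihedralGroup n))) ⊔
      adjoin K (Set.range (fun i => ndEy K n (u i))))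
    (fun i => ndX K (Sum.elim NdI.a NdI.b i : NdI n)) hL hfaith
    (by
      intro g i
      have hh : ∃ j, ndAct g (Sum.elim NdI.a NdI.b i : NdI n) = Sum.elim NdI.a NdI.b j := by
        obtain ⟨c, (k | k)⟩ := g <;> obtain (i | i) := i
        · exact ⟨.inl _, rfl⟩
        · exact ⟨.inr _, rfl⟩
        · exact ⟨.inr _, rfl⟩
        · exact ⟨.inl _, rfl⟩
      obtain ⟨j, hj⟩ := hh
      exact ⟨j, by rw [ndρ_X, hj]⟩)
    (fun x hx hx' => nd_fix_xy K n u hu hu' x hx hx')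
    (by
      intro L' h1 h2
      apply nd_sup_eq_top
      intro i
      have h3 := le_sup_left.trans h1
      have h4 := le_sup_right.trans h1
      rcases i with d | c | c | c
      · exact h3 (ndX_mem_x K n d)
      · exact h4 (ndX_mem_y K n c)
      · exact h2 (.inl c)
      · exact h2 (.inr c))
  obtain ⟨Z, h1, h2, h3, h4⟩ := key
  refine ⟨Z, h1, h2.trans_eq ?_, h3, h4⟩
  simp only [Fintype.card_sum, Fintype.card_multiplicative, ZMod.card]
  omega

/-- second description of the invariants -/
theorem nd_desc2 (K : Type*) [Field K] (n : ℕ) [NeZero n] (h : ZMod n) (hh : h + h = 1) {m : ℕ}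
    (u : Fin m → NoetherBigField K (Multiplicative (ZMod n)))
    (hu : ∀ g i, noetherAut K _ g (u i) = u i)
    (hu' : ∀ f, (∀ g, noetherAut K _ g f = f) → f ∈ adjoin K (Set.range u)) :
    ∃ Z : Set (NoetherBigField K (NdI n)), Z.Finite ∧ Z.ncard ≤ 3 * n ∧
      (∀ z ∈ Z, ∀ g, ndρ K n g z = z) ∧ ∃ s : Fin m ⊕ Fin m → NoetherBigField K (NdI n),
      (∀ i g, ndρ K n g (s i) = s i) ∧
      ∀ f, (∀ g, ndρ K n g f = f) → f ∈ adjoin K (Set.range s) ⊔ adjoin K Z := by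
  have hL : ∀ g, ∀ x ∈ (ndEa K n).fieldRange ⊔ (ndEb K n).fieldRange,
      ndρ K n g x ∈ (ndEa K n).fieldRange ⊔ (ndEb K n).fieldRange := by
    intro g
    apply nd_sup_stab
    · rintro _ ⟨x, rfl⟩
      obtain ⟨c, (k | k)⟩ := g
      · exact (le_sup_left : _ ≤ (ndEa K n).fieldRange ⊔ _) ⟨_, (ndρ_ar K n c k x).symm⟩
      · exact (le_sup_right : (ndEb K n).fieldRange ≤ _) ⟨_, (ndρ_as K n c k x).symm⟩
    · rintro _ ⟨x, rfl⟩
      obtain ⟨c, (k | k)⟩ := g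
      · exact (le_sup_right : (ndEb K n).fieldRange ≤ _) ⟨_, (ndρ_br K n c k x).symm⟩
      · exact (le_sup_left : _ ≤ (ndEa K n).fieldRange ⊔ _) ⟨_, (ndρ_bs K n c k x).symm⟩
  have hfaith : ∀ g, (∀ x ∈ (ndEa K n).fieldRange ⊔ (ndEb K n).fieldRange,
      ndρ K n g x = x) → g = 1 := by
    intro g hg
    apply nd_faith_ab n h hh g
    · intro c
      have h1 := hg _ ((le_sup_left : _ ≤ (ndEa K n).fieldRange ⊔ _) (ndX_mem_a K n c))
      rw [ndρ_X] at h1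
      exact ndX_injective K h1
    · intro c
      have h1 := hg _ ((le_sup_right : (ndEb K n).fieldRange ≤ _) (ndX_mem_b K n c))
      rw [ndρ_X] at h1
      exact ndX_injective K h1
  obtain ⟨s, hs1, hs2, hs3⟩ := nd_swap (ndρ K n (1, .sr 0)) (fun i => ndEa K n (u i))
    (fun i => ndEb K n (u i))
    (fun i => by rw [ndρ_as, hu]) (fun i => by rw [ndρ_bs, hu])
  have key := nd_combo (ι := DihedralGroup n ⊕ Multiplicative (ZMod n)) (ndρ K n)
    ((ndEa K n).fieldRange ⊔ (ndEb K n).fieldRange) (adjoin K (Set.range s))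
    (fun i => ndX K (Sum.elim NdI.x NdI.y i : NdI n)) hL hfaith
    (by
      intro g i
      have hh : ∃ j, ndAct g (Sum.elim NdI.x NdI.y i : NdI n) = Sum.elim NdI.x NdI.y j := by
        obtain ⟨c, d⟩ := g
        obtain (i | i) := i
        · exact ⟨.inl _, rfl⟩
        · exact ⟨.inr _, rfl⟩
      obtain ⟨j, hj⟩ := hh
      exact ⟨j, by rw [ndρ_X, hj]⟩)
    (fun x hx hx' => hs3 x (nd_fix_ab K n h hh u hu hu' x hx hx') (hx' _))
    (by
      intro L' h1 h2
      apply nd_sup_eq_top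
      intro i
      have h3 := le_sup_left.trans h1
      have h4 := le_sup_right.trans h1
      rcases i with d | c | c | c
      · exact h2 (.inl d)
      · exact h2 (.inr c)
      · exact h3 (ndX_mem_a K n c)
      · exact h4 (ndX_mem_b K n c))
  obtain ⟨Z, h1, h2, h3, h4⟩ := key
  refine ⟨Z, h1, h2.trans_eq ?_, h3, s, ?_, h4⟩
  · simp only [Fintype.card_sum, DihedralGroup.card, Fintype.card_multiplicative, ZMod.card]
    omega
  · -- rotations fix all of K(u_a, u_b)
    have hrot : ∀ c k i, ndρ K n (c, .r k) (s i) = s i := by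
      intro c k i
      have := nd_fixed_adjoin ((ndρ K n).comp (Subgroup.zpowers ((c, .r k) : NdG n)).subtype)
        (Set.range (fun i => ndEa K n (u i)) ∪ Set.range (fun i => ndEb K n (u i)))
        (by
          rintro _ hx ⟨g, z, rfl⟩
          have key : ∀ c' k', ∀ x ∈ Set.range (fun i => ndEa K n (u i)) ∪
              Set.range (fun i => ndEb K n (u i)), ndρ K n (c', .r k') x = x := by
            rintro c' k' _ (⟨i, rfl⟩ | ⟨i, rfl⟩)
            · rw [ndρ_ar, hu]
            · rw [ndρ_br, hu]
          have hz : ((c, .r k) : NdG n) ^ z = (c ^ z, .r (k * z)) := by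
            ext1 <;> simp
          change ndρ K n (((c, .r k) : NdG n) ^ z) _ = _
          rw [hz]
          exact key _ _ _ hx) (s i) (hs1 i) ⟨_, Subgroup.mem_zpowers _⟩
      exact this
    rintro i ⟨c, (k | k)⟩
    · exact hrot c k i
    · have e : ((c, .sr k) : NdG n) = (1, .sr 0) * (c, .r k) := by simp
      rw [e, map_mul, AlgEquiv.mul_apply, hrot, hs2]

theorem nd_enum {M : Type*} (Z : Set M) (hZ : Z.Finite) : ∃ z : Fin Z.ncard → M, Set.range z = Z := by
  have : Finite Z := hZ
  let e : Z ≃ Fin Z.ncard := Finite.equivFinOfCardEq rfl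
  refine ⟨fun i => (e.symm i : M), ?_⟩
  ext x
  constructor
  · rintro ⟨i, rfl⟩
    exact (e.symm i).2
  · intro hx
    exact ⟨e ⟨x, hx⟩, by simp⟩

/-- abstract form of the final argument -/
theorem nd_glue.{u, w} {K N M : Type u} {H : Type w} [Field K] [Field N] [Field M] [Algebra K N]
    [Algebra K M] [Group H] [Finite H] (ρ : H →* (M ≃ₐ[K] M)) (v : N →ₐ[K] M)
    (hv : ∀ x h, ρ h (v x) = v x) {m n : ℕ} (w : Fin m → M) (hw : ∀ i h, ρ h (w i) = w i)
    (Z₁ : Set M) (hZ₁ : Z₁.Finite) (hc₁ : Z₁.ncard ≤ 2 * n) (hf₁ : ∀ z ∈ Z₁, ∀ h, ρ h z = z)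
    (h₁ : ∀ f, (∀ h, ρ h f = f) →
      f ∈ adjoin K (Set.range v) ⊔ adjoin K (Set.range w) ⊔ adjoin K Z₁)
    (s : Fin m ⊕ Fin m → M) (hs : ∀ i h, ρ h (s i) = s i)
    (Z₂ : Set M) (hZ₂ : Z₂.Finite) (hc₂ : Z₂.ncard ≤ 3 * n) (hf₂ : ∀ z ∈ Z₂, ∀ h, ρ h z = z)
    (h₂ : ∀ f, (∀ h, ρ h f = f) → f ∈ adjoin K (Set.range s) ⊔ adjoin K Z₂)
    (hm : m ≤ n) (hM : Algebra.trdeg K M = ((5 * n : ℕ) : Cardinal))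
    (hN : Algebra.trdeg K N ≤ ((2 * n : ℕ) : Cardinal)) : IsStablyRationalExtension K N := by
  let _ : Algebra N M := v.toRingHom.toAlgebra
  have : IsScalarTower K N M := IsScalarTower.of_algebraMap_eq (fun x => (v.commutes x).symm)
  obtain ⟨z₁, hz₁⟩ := nd_enum Z₁ hZ₁
  obtain ⟨z₂, hz₂⟩ := nd_enum Z₂ hZ₂
  have r₁ : Set.range (Sum.elim w z₁) = Set.range w ∪ Z₁ := by rw [Set.Sum.elim_range, hz₁]
  have r₂ : Set.range (Sum.elim s z₂) = Set.range s ∪ Z₂ := by rw [Set.Sum.elim_range, hz₂]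
  have g₁ : ∀ f, (∀ h, ρ h f = f) → f ∈ adjoin N (Set.range (Sum.elim w z₁)) := by
    intro f hf
    have h3 := h₁ f hf
    have h4 : adjoin K (Set.range v) ⊔ adjoin K (Set.range w) ⊔ adjoin K Z₁ ≤
        (adjoin N (Set.range (Sum.elim w z₁))).restrictScalars K := by
      rw [r₁]
      refine sup_le (sup_le ?_ ?_) ?_
      · rw [adjoin_le_iff]
        rintro _ ⟨x, rfl⟩
        exact (adjoin N _).algebraMap_mem x
      · rw [adjoin_le_iff]
        intro x hx
        exact subset_adjoin N _ (Or.inl hx)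
      · rw [adjoin_le_iff]
        intro x hx
        exact subset_adjoin N _ (Or.inr hx)
    exact h4 h3
  have g₂ : ∀ f, (∀ h, ρ h f = f) → f ∈ adjoin K (Set.range (Sum.elim s z₂)) := by
    intro f hf
    rw [r₂, adjoin_union]
    exact h₂ f hf
  have k₂ : ∀ f ∈ adjoin K (Set.range (Sum.elim s z₂)), ∀ h, ρ h f = f := by
    intro f hf h
    refine nd_fixed_adjoin ρ _ ?_ f hf h
    rw [r₂]
    rintro _ (⟨i, rfl⟩ | hx) h
    · exact hs i h
    · exact hf₂ _ hx h
  have k₁ : ∀ f ∈ adjoin N (Set.range (Sum.elim w z₁)), ∀ h, ρ h f = f := by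
    intro f hf h
    rw [r₁] at hf
    induction hf using adjoin_induction with
    | mem x hx =>
      obtain (⟨i, rfl⟩ | hx) := hx
      · exact hw i h
      · exact hf₁ _ hx h
    | algebraMap x => exact hv x h
    | add x y _ _ hx hy => rw [map_add, hx, hy]
    | inv x _ hx => rw [map_inv₀, hx]
    | mul x y _ _ hx hy => rw [map_mul, hx, hy]
  have hNM : ((3 * n : ℕ) : Cardinal) ≤ Algebra.trdeg N M := by
    have h5 := trdeg_add_eq K N (A := M)
    rw [hM] at h5
    obtain ⟨a, ha⟩ := Cardinal.lt_aleph0.mp (hN.trans_lt (Cardinal.natCast_lt_aleph0))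
    have hb' : Algebra.trdeg N M ≤ ((5 * n : ℕ) : Cardinal) := by
      rw [← h5]; exact self_le_add_left _ _
    obtain ⟨b, hb⟩ := Cardinal.lt_aleph0.mp (hb'.trans_lt (Cardinal.natCast_lt_aleph0))
    rw [ha] at hN h5
    rw [hb] at h5 ⊢
    have h6 : a ≤ 2 * n := by exact_mod_cast hN
    have h7 : a + b = 5 * n := by exact_mod_cast h5
    have h8 : 3 * n ≤ b := by omega
    exact_mod_cast h8
  refine nd_final (Sum.elim w z₁) (Sum.elim s z₂) (nd_indep ρ _ g₁ (le_trans ?_ hNM))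
    (nd_indep ρ _ g₂ (le_of_le_of_eq ?_ hM.symm)) (fun f => ⟨fun h => g₂ f (k₁ f h), fun h => g₁ f (k₂ f h)⟩)
  · rw [Fintype.card_sum, Fintype.card_fin, Fintype.card_fin, Nat.cast_le]
    omega
  · rw [Fintype.card_sum, Fintype.card_sum, Fintype.card_fin, Fintype.card_fin, Nat.cast_le]
    omega

/-- the fixed field inside the big field -/
def ndVal (K : Type*) [Field K] (G : Type*) [Group G] : NoetherField K G →ₐ[K] NoetherBigField K G :=
  { (noetherSubfield K G).subtype with commutes' := fun _ => rfl }

/-- Theorem 4.2 (first part): for any field `K` and odd `n`, if `K(ℤ/nℤ)` is rational over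
`K`, then `K(Dₙ)` is stably rational over `K`. -/
theorem noether_dihedral_stably_rational
    (K : Type*) [Field K] (n : ℕ) (hn : Odd n) (hpos : 0 < n)
    (hcyc : IsRationalExtension K (NoetherField K (Multiplicative (ZMod n)))) :
    IsStablyRationalExtension K (NoetherField K (DihedralGroup n)) := by
  haveI : NeZero n := ⟨hpos.ne'⟩
  obtain ⟨h, hh⟩ : ∃ h : ZMod n, h + h = 1 := by
    obtain ⟨k, hk⟩ := hn
    refine ⟨((k + 1 : ℕ) : ZMod n), ?_⟩
    have h0 : ((2 * k + 1 : ℕ) : ZMod n) = 0 := by rw [← hk]; exact ZMod.natCast_self n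
    push_cast at h0 ⊢
    linear_combination h0
  obtain ⟨m, hm, u, hu, hu'⟩ := nd_cyc hcyc
  obtain ⟨Z₁, a1, a2, a3, a4⟩ := nd_desc1 K n u hu hu'
  obtain ⟨Z₂, b1, b2, b3, s, b4, b5⟩ := nd_desc2 K n h hh u hu hu'
  have hr : Set.range ((ndEx K n).comp (ndVal K (DihedralGroup n))) =
      ndEx K n '' (noetherSubfield K (DihedralGroup n)) := by
    ext x
    constructor
    · rintro ⟨y, rfl⟩
      exact ⟨y.1, y.2, rfl⟩
    · rintro ⟨y, hy, rfl⟩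
      exact ⟨⟨y, hy⟩, rfl⟩
  refine nd_glue (n := n) (ndρ K n) ((ndEx K n).comp (ndVal K (DihedralGroup n))) ?_
    (fun i => ndEy K n (u i)) ?_ Z₁ a1 a2 a3 ?_ s b4 Z₂ b1 b2 b3 b5 ?_ ?_ ?_
  · intro x g
    exact (ndρ_x K n g _).trans (congrArg (ndEx K n) (x.2 g.2))
  · intro i g
    rw [ndρ_y, hu]
  · rw [hr]
    exact a4
  · simpa only [Fintype.card_multiplicative, ZMod.card] using hm
  · rw [nd_trdeg, nd_card]
  · have := trdeg_le_of_injective (ndVal K (DihedralGroup n)) (ndVal K (DihedralGroup n)).toRingHom.injective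
    rwa [nd_trdeg, DihedralGroup.card] at this

end
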